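/- For every point of the form (x, 0, 0) with x ≥ 0, the real numbers a2 and a3 are eigenvalues of the Jacobian matrix J(x,0,0) of the vector field F. Consequently the axial equilibrium E_4 = (a1/b1, 0, 0) has the positive eigenvalues a2 and a3 and is unstable. -/

import Mathlib

/-- The eco-epidemic vector field `F` on `ℝ³`. -/
noncomputable def ecoField (a1 a2 a3 b1 c1 c2 c3 k1 k2 θ p : ℝ)
    (v : Fin 3 → ℝ) : Fin 3 → ℝ :=
  ![a1 * v 0 - b1 * (v 0) ^ 2 - c1 * (v 0) ^ 2 * v 1 / (k1 + (v 0) ^ 2)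
      - p * c1 * (v 0) ^ 2 * v 2 / (k1 + (v 0) ^ 2),
    a2 * v 1 - c2 * v 1 * (v 1 + v 2) / (k2 + v 0) - θ * v 1 * v 2,
    θ * v 1 * v 2 + a3 * v 2 - c3 * v 2 * (v 1 + v 2) / (k2 + v 0)]

/-- The Jacobian matrix of the eco-epidemic vector field at a point. -/
noncomputable def ecoJacobian (a1 a2 a3 b1 c1 c2 c3 k1 k2 θ p : ℝ)
    (pt : Fin 3 → ℝ) : Matrix (Fin 3) (Fin 3) ℝ :=
  fun i j =>
    fderiv ℝ (fun v => ecoField a1 a2 a3 b1 c1 c2 c3 k1 k2 θ p v i) pt (Pi.single j 1)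

/-- If `f v = v i * g v` near a point with vanishing `i`-th coordinate, then the derivative of `f`
there is `g pt` times the `i`-th coordinate. -/
lemma fderiv_coord_mul (g : (Fin 3 → ℝ) → ℝ) (pt : Fin 3 → ℝ) (i : Fin 3) (h0 : pt i = 0)
    (hg : DifferentiableAt ℝ g pt) (w : Fin 3 → ℝ) :
    fderiv ℝ (fun v : Fin 3 → ℝ => v i * g v) pt w = g pt * w i := by
  have h1 : HasFDerivAt (fun v : Fin 3 → ℝ => v i)
      (ContinuousLinearMap.proj (R := ℝ) (φ := fun _ : Fin 3 => ℝ) i) pt :=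
    hasFDerivAt_apply i pt
  have h := (h1.mul hg.hasFDerivAt).fderiv
  have h' : fderiv ℝ (fun v : Fin 3 → ℝ => v i * g v) pt = _ := h
  rw [h']
  simp [h0]

/-- Block-triangular matrices with these rows have the eigenvalues `a` and `b`. -/
lemma eig_of_rows (M : Matrix (Fin 3) (Fin 3) ℝ) (a b : ℝ)
    (h10 : M 1 0 = 0) (h11 : M 1 1 = a) (h12 : M 1 2 = 0)
    (h20 : M 2 0 = 0) (h21 : M 2 1 = 0) (h22 : M 2 2 = b) :
    (∃ v : Fin 3 → ℝ, v ≠ 0 ∧ M.mulVec v = a • v) ∧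
    (∃ v : Fin 3 → ℝ, v ≠ 0 ∧ M.mulVec v = b • v) := by
  constructor
  · by_cases h : M 0 0 = a
    · refine ⟨![1, 0, 0], fun hv => by simpa using congrFun hv 0, ?_⟩
      ext i
      fin_cases i <;> simp [Matrix.mulVec, dotProduct, Fin.sum_univ_three, *]
    · have h' : a - M 0 0 ≠ 0 := sub_ne_zero.mpr (Ne.symm h)
      refine ⟨![M 0 1, a - M 0 0, 0], fun hv => h' (by simpa using congrFun hv 1), ?_⟩
      ext i
      fin_cases i <;> simp [Matrix.mulVec, dotProduct, Fin.sum_univ_three, h10, h11, h20, h21]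
      ring
  · by_cases h : M 0 0 = b
    · refine ⟨![1, 0, 0], fun hv => by simpa using congrFun hv 0, ?_⟩
      ext i
      fin_cases i <;> simp [Matrix.mulVec, dotProduct, Fin.sum_univ_three, *]
    · have h' : b - M 0 0 ≠ 0 := sub_ne_zero.mpr (Ne.symm h)
      refine ⟨![M 0 2, 0, b - M 0 0], fun hv => h' (by simpa using congrFun hv 2), ?_⟩
      ext i
      fin_cases i <;> simp [Matrix.mulVec, dotProduct, Fin.sum_univ_three, h10, h12, h20, h22]
      ring

/-- At any point of the `x`-axis, `a2` and `a3` are eigenvalues of the Jacobian; in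
particular the axial equilibrium `E4 = (a1/b1, 0, 0)` has the positive eigenvalues
`a2` and `a3`. -/
theorem a2_a3_eigenvalues_on_x_axis
    (a1 a2 a3 b1 c1 c2 c3 k1 k2 θ p : ℝ)
    (ha1 : 0 < a1) (ha2 : 0 < a2) (ha3 : 0 < a3) (hb1 : 0 < b1)
    (hc1 : 0 < c1) (hc2 : 0 < c2) (hc3 : 0 < c3)
    (hk1 : 0 < k1) (hk2 : 0 < k2) (hθ : 0 < θ) (hp : 0 < p) (hp1 : p ≤ 1) :
    (∀ x : ℝ, 0 ≤ x →
      (∃ v : Fin 3 → ℝ, v ≠ 0 ∧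
        (ecoJacobian a1 a2 a3 b1 c1 c2 c3 k1 k2 θ p ![x, 0, 0]).mulVec v = a2 • v) ∧
      (∃ v : Fin 3 → ℝ, v ≠ 0 ∧
        (ecoJacobian a1 a2 a3 b1 c1 c2 c3 k1 k2 θ p ![x, 0, 0]).mulVec v = a3 • v)) ∧
    0 < a2 ∧ 0 < a3 ∧
    (∃ v : Fin 3 → ℝ, v ≠ 0 ∧
      (ecoJacobian a1 a2 a3 b1 c1 c2 c3 k1 k2 θ p ![a1 / b1, 0, 0]).mulVec v = a2 • v) ∧
    (∃ v : Fin 3 → ℝ, v ≠ 0 ∧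
      (ecoJacobian a1 a2 a3 b1 c1 c2 c3 k1 k2 θ p ![a1 / b1, 0, 0]).mulVec v = a3 • v) := by
  have key : ∀ x : ℝ, 0 ≤ x →
      (∃ v : Fin 3 → ℝ, v ≠ 0 ∧
        (ecoJacobian a1 a2 a3 b1 c1 c2 c3 k1 k2 θ p ![x, 0, 0]).mulVec v = a2 • v) ∧
      (∃ v : Fin 3 → ℝ, v ≠ 0 ∧
        (ecoJacobian a1 a2 a3 b1 c1 c2 c3 k1 k2 θ p ![x, 0, 0]).mulVec v = a3 • v) := by
    intro x hx
    have hne : k2 + (![x, 0, 0] : Fin 3 → ℝ) 0 ≠ 0 := by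
      simp only [Matrix.cons_val_zero]
      positivity
    have r1 : ∀ j, ecoJacobian a1 a2 a3 b1 c1 c2 c3 k1 k2 θ p ![x, 0, 0] 1 j
        = a2 * (Pi.single j 1 : Fin 3 → ℝ) 1 := by
      intro j
      have e : (fun v => ecoField a1 a2 a3 b1 c1 c2 c3 k1 k2 θ p v 1)
          = fun v : Fin 3 → ℝ => v 1 * (a2 - c2 * (v 1 + v 2) / (k2 + v 0) - θ * v 2) := by
        funext v
        simp only [ecoField, Matrix.cons_val_one, Matrix.cons_val_zero]
        ring
      unfold ecoJacobian
      rw [e, fderiv_coord_mul _ _ 1 (by simp) (by fun_prop (disch := exact hne))]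
      simp
    have r2 : ∀ j, ecoJacobian a1 a2 a3 b1 c1 c2 c3 k1 k2 θ p ![x, 0, 0] 2 j
        = a3 * (Pi.single j 1 : Fin 3 → ℝ) 2 := by
      intro j
      have e : (fun v => ecoField a1 a2 a3 b1 c1 c2 c3 k1 k2 θ p v 2)
          = fun v : Fin 3 → ℝ => v 2 * (θ * v 1 + a3 - c3 * (v 1 + v 2) / (k2 + v 0)) := by
        funext v
        simp only [ecoField, Matrix.cons_val]
        ring
      unfold ecoJacobian
      rw [e, fderiv_coord_mul _ _ 2 (by simp) (by fun_prop (disch := exact hne))]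
      simp
    apply eig_of_rows <;> simp [r1, r2]
  have hE := key (a1 / b1) (by positivity)
  exact ⟨key, ha2, ha3, hE.1, hE.2⟩
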